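/- Under the PIGD setup, assume additionally that argmin F is nonempty and that the inertial parameters are β_k = 1/(k+1)^θ for some θ > 1. Then F(x^k) − min F = O(1/k), i.e., there exists C > 0 such that F(x^k) − min F ≤ C/k for all k ≥ 1. (No coercivity of F is assumed.) -/

import Mathlib

open Finset in
/-- A quasi-Fejér recursion for `D` whose perturbation is controlled by a Lyapunov function
`a + w * d` forces the Lyapunov function, hence `a`, to decay like `1 / j`. -/
theorem exists_le_div_of_lyapunov_of_quasiFejer {a d D w b : ℕ → ℝ} {κ W m : ℝ}
    (hκ : 0 < κ) (hm : 0 < m)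
    (ha : ∀ j, 0 ≤ a j) (hd : ∀ j, 0 ≤ d j) (hD : ∀ j, 0 ≤ D j) (hw : ∀ j, 0 ≤ w j)
    (hwW : ∀ j, w j ≤ W) (hb : ∀ j, 0 ≤ b j) (hbs : Summable b)
    (hlyap : ∀ j, a (j + 1) + w (j + 1) * d (j + 1) + κ * d (j + 1) ≤ a j + w j * d j)
    (hfejer : ∀ j, D (j + 1) + m * a (j + 1) ≤ (1 + b j) * D j + (3 * d (j + 1) + 2 * d j)) :
    ∃ C : ℝ, 0 < C ∧ ∀ j : ℕ, a j ≤ C / ((j : ℝ) + 1) := by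
  set h : ℕ → ℝ := fun j => a j + w j * d j with hh
  have h0 : ∀ j, 0 ≤ h j := fun j => add_nonneg (ha j) (mul_nonneg (hw j) (hd j))
  have hanti : Antitone h := antitone_nat_of_succ_le fun j => by
    have := hlyap j
    have := mul_nonneg hκ.le (hd (j + 1))
    simp only [hh]; linarith
  have hsumd : ∀ N, ∑ j ∈ range N, d (j + 1) ≤ h 0 / κ := by
    intro N
    have : κ * ∑ j ∈ range N, d (j + 1) + h N ≤ h 0 := by
      induction N with
      | zero => simp
      | succ N ih =>
        rw [sum_range_succ]
        have := hlyap N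
        simp only [hh] at ih ⊢
        linarith
    rw [le_div_iff₀ hκ]
    linarith [h0 N]
  have hsumd' : ∀ N, ∑ j ∈ range N, d j ≤ d 0 + h 0 / κ := by
    intro N
    have h1 : ∑ j ∈ range N, d j ≤ ∑ j ∈ range (N + 1), d j :=
      sum_le_sum_of_subset_of_nonneg (range_mono N.le_succ) fun j _ _ => hd j
    rw [sum_range_succ'] at h1
    linarith [hsumd N]
  have hgron : ∀ N, D N + m * ∑ j ∈ range N, a (j + 1) ≤
      Real.exp (∑ j ∈ range N, b j) * (D 0 + ∑ j ∈ range N, (3 * d (j + 1) + 2 * d j)) := by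
    intro N
    induction N with
    | zero => simp
    | succ N ih =>
      rw [sum_range_succ, sum_range_succ, sum_range_succ]
      set A := ∑ j ∈ range N, a (j + 1)
      set B := ∑ j ∈ range N, b j
      set S := ∑ j ∈ range N, (3 * d (j + 1) + 2 * d j)
      set e := 3 * d (N + 1) + 2 * d N
      have hA : 0 ≤ m * A := mul_nonneg hm.le (sum_nonneg fun j _ => ha _)
      have hB : 0 ≤ B := sum_nonneg fun j _ => hb j
      have he : 0 ≤ e := by linarith [hd (N + 1), hd N]
      have h1 : (1 + b N) * (D N + m * A) ≤ Real.exp (b N) * (Real.exp B * (D 0 + S)) :=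
        mul_le_mul (by linarith [Real.add_one_le_exp (b N)]) ih
          (add_nonneg (hD N) hA) (Real.exp_pos _).le
      have h2 : e ≤ Real.exp (B + b N) * e :=
        le_mul_of_one_le_left he (Real.one_le_exp (add_nonneg hB (hb N)))
      have h3 := hfejer N
      have h4 := mul_nonneg (hb N) hA
      rw [Real.exp_add] at h2 ⊢
      nlinarith
  set R := Real.exp (∑' j, b j) * (D 0 + (3 * (h 0 / κ) + 2 * (d 0 + h 0 / κ))) with hR
  have hsuma : ∀ N, ∑ j ∈ range N, a (j + 1) ≤ R / m := by
    intro N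
    rw [le_div_iff₀ hm]
    have h1 : Real.exp (∑ j ∈ range N, b j) * (D 0 + ∑ j ∈ range N, (3 * d (j + 1) + 2 * d j))
        ≤ R := by
      refine mul_le_mul (Real.exp_le_exp.2 (hbs.sum_le_tsum _ fun j _ => hb j)) ?_ ?_
        (Real.exp_pos _).le
      · rw [sum_add_distrib, ← mul_sum, ← mul_sum]
        linarith [hsumd N, hsumd' N]
      · exact add_nonneg (hD 0) (sum_nonneg fun j _ => by linarith [hd (j + 1), hd j])
    linarith [hgron N, hD N]
  have hW : 0 ≤ W := (hw 0).trans (hwW 0)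
  have hR0 : 0 ≤ R / m := by simpa using hsuma 0
  have hq0 : 0 ≤ h 0 / κ := div_nonneg (h0 0) hκ.le
  refine ⟨h 0 + R / m + W * (h 0 / κ) + 1, by have := h0 0; positivity, fun N => ?_⟩
  rw [le_div_iff₀ (by positivity)]
  have h1 : (N : ℝ) * h N ≤ ∑ j ∈ range N, h (j + 1) := by
    have := card_nsmul_le_sum (range N) (fun j => h (j + 1)) (h N)
      fun j hj => hanti (Nat.succ_le_of_lt (mem_range.1 hj))
    simpa using this
  have h2 : ∑ j ∈ range N, h (j + 1) ≤ R / m + W * (h 0 / κ) := by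
    calc ∑ j ∈ range N, h (j + 1)
        ≤ ∑ j ∈ range N, (a (j + 1) + W * d (j + 1)) := sum_le_sum fun j _ => by
          have := mul_le_mul_of_nonneg_right (hwW (j + 1)) (hd (j + 1))
          simp only [hh]; linarith
      _ = ∑ j ∈ range N, a (j + 1) + W * ∑ j ∈ range N, d (j + 1) := by
          rw [sum_add_distrib, ← mul_sum]
      _ ≤ _ := add_le_add (hsuma N) (mul_le_mul_of_nonneg_left (hsumd N) hW)
  have h3 : h N ≤ h 0 := hanti N.zero_le
  have h4 : a N * (N + 1) ≤ h N * (N + 1) := by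
    refine mul_le_mul_of_nonneg_right ?_ (by positivity)
    have := mul_nonneg (hw N) (hd N)
    simp only [hh]; linarith
  linarith

section ProximalGradient

open scoped InnerProductSpace

variable {E : Type*} [NormedAddCommGroup E] [InnerProductSpace ℝ E]

theorem HasGradientAt.hasDerivAt_add_smul [CompleteSpace E] {f : E → ℝ} {f' x v : E} {t : ℝ}
    (hf : HasGradientAt f f' (x + t • v)) :
    HasDerivAt (fun s : ℝ => f (x + s • v)) ⟪f', v⟫_ℝ t := by
  have h1 : HasDerivAt (fun s : ℝ => x + s • v) v t := by
    simpa using ((hasDerivAt_id t).smul_const v).const_add x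
  have h2 := hf.hasFDerivAt.comp_hasDerivAt t h1
  rw [InnerProductSpace.toDual_apply_apply] at h2
  exact h2

/-- The descent lemma for functions with Lipschitz gradient. -/
theorem le_add_inner_add_of_lipschitz_gradient [CompleteSpace E] {f : E → ℝ} {f' : E → E} {L : ℝ}
    (hf : ∀ x, HasGradientAt f (f' x) x) (hlip : ∀ x y, ‖f' x - f' y‖ ≤ L * ‖x - y‖) (x y : E) :
    f y ≤ f x + ⟪f' x, y - x⟫_ℝ + L / 2 * ‖y - x‖ ^ 2 := by
  set v := y - x with hv
  have hder : ∀ t : ℝ, HasDerivAt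
      (fun s : ℝ => f (x + s • v) - s * ⟪f' x, v⟫_ℝ - L / 2 * ‖v‖ ^ 2 * s ^ 2)
      (⟪f' (x + t • v), v⟫_ℝ - ⟪f' x, v⟫_ℝ - L * ‖v‖ ^ 2 * t) t := by
    intro t
    have h := (((hf (x + t • v)).hasDerivAt_add_smul).sub
      ((hasDerivAt_id t).mul_const ⟪f' x, v⟫_ℝ)).sub
      ((hasDerivAt_pow 2 t).const_mul (L / 2 * ‖v‖ ^ 2))
    refine h.congr_deriv ?_
    push_cast
    ring
  have hanti := antitoneOn_of_deriv_nonpos (convex_Icc (0 : ℝ) 1)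
    (fun t _ => (hder t).continuousAt.continuousWithinAt)
    (fun t _ => (hder t).differentiableAt.differentiableWithinAt)
    (fun t ht => by
      rw [interior_Icc] at ht
      rw [(hder t).deriv, ← inner_sub_left]
      have h1 := real_inner_le_norm (f' (x + t • v) - f' x) v
      have h2 := hlip (x + t • v) x
      rw [add_sub_cancel_left, norm_smul, Real.norm_of_nonneg ht.1.le] at h2
      have h3 := mul_le_mul_of_nonneg_right h2 (norm_nonneg v)
      nlinarith)
  have := hanti (Set.left_mem_Icc.2 zero_le_one) (Set.right_mem_Icc.2 zero_le_one) zero_le_one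
  simp [hv] at this
  linarith

/-- The first-order characterization of convexity. -/
theorem ConvexOn.add_inner_gradient_le [CompleteSpace E] {f : E → ℝ} {f' x : E}
    (hf : ConvexOn ℝ Set.univ f) (hf' : HasGradientAt f f' x) (y : E) :
    f x + ⟪f', y - x⟫_ℝ ≤ f y := by
  have hc : ConvexOn ℝ Set.univ (fun s : ℝ => f (x + s • (y - x))) := by
    have := hf.comp_affineMap (AffineMap.lineMap x y : ℝ →ᵃ[ℝ] E)
    have heq : (fun s : ℝ => f (x + s • (y - x))) = f ∘ (AffineMap.lineMap x y : ℝ →ᵃ[ℝ] E) := by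
      funext s
      simp [AffineMap.lineMap_apply, add_comm]
    rw [heq]
    exact this
  have hd : HasDerivAt (fun s : ℝ => f (x + s • (y - x))) ⟪f', y - x⟫_ℝ 0 :=
    HasGradientAt.hasDerivAt_add_smul (by simpa using hf')
  have := hc.le_slope_of_hasDerivAt (Set.mem_univ 0) (Set.mem_univ 1) zero_lt_one hd
  simp [slope_def_field] at this
  linarith

/-- The variational inequality satisfied by a proximal point. -/
theorem ConvexOn.add_inner_le_of_isMinOn_prox {g : E → ℝ} (hg : ConvexOn ℝ Set.univ g) {γ : ℝ}
    (hγ : 0 < γ) {y p : E}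
    (hp : IsMinOn (fun z => ‖z - y‖ ^ 2 / (2 * γ) + g z) Set.univ p) (z : E) :
    γ * g p + ⟪y - p, z - p⟫_ℝ ≤ γ * g z := by
  have key : ∀ t : ℝ, 0 < t → t ≤ 1 →
      γ * g p + ⟪y - p, z - p⟫_ℝ ≤ γ * g z + t * (‖z - p‖ ^ 2 / 2) := by
    intro t ht ht1
    have h1 : ‖p - y‖ ^ 2 / (2 * γ) + g p ≤
        ‖p + t • (z - p) - y‖ ^ 2 / (2 * γ) + g (p + t • (z - p)) := hp (Set.mem_univ _)
    have h2 : g (p + t • (z - p)) ≤ (1 - t) * g p + t * g z := by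
      have := hg.2 (Set.mem_univ p) (Set.mem_univ z) (sub_nonneg.2 ht1) ht.le (by ring)
      rwa [smul_eq_mul, smul_eq_mul,
        show (1 - t) • p + t • z = p + t • (z - p) by module] at this
    have h3 : ‖p + t • (z - p) - y‖ ^ 2 =
        ‖p - y‖ ^ 2 - 2 * t * ⟪y - p, z - p⟫_ℝ + t ^ 2 * ‖z - p‖ ^ 2 := by
      rw [show p + t • (z - p) - y = (p - y) + t • (z - p) by abel, norm_add_sq_real,
        inner_smul_right, norm_smul, Real.norm_of_nonneg ht.le, ← neg_sub y p, inner_neg_left]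
      ring
    rw [h3] at h1
    have h4 := mul_le_mul_of_nonneg_left (h1.trans ((add_le_add_iff_left _).2 h2)) hγ.le
    field_simp at h4
    have h5 : 0 ≤ t * (γ * g z + t * (‖z - p‖ ^ 2 / 2) - (γ * g p + ⟪y - p, z - p⟫_ℝ)) := by
      nlinarith
    linarith [nonneg_of_mul_nonneg_right h5 ht]
  have hlim : Filter.Tendsto (fun t : ℝ => γ * g z + t * (‖z - p‖ ^ 2 / 2))
      (nhdsWithin 0 (Set.Ioi 0)) (nhds (γ * g z)) := by
    have : Continuous fun t : ℝ => γ * g z + t * (‖z - p‖ ^ 2 / 2) := by fun_prop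
    simpa using (this.tendsto 0).mono_left nhdsWithin_le_nhds
  refine ge_of_tendsto hlim ?_
  filter_upwards [Ioc_mem_nhdsGT zero_lt_one] with t ht using key t ht.1 ht.2

/-- The basic inequality for one step of the inertial proximal gradient method. -/
theorem inertial_proximal_gradient_step [CompleteSpace E] {f g : E → ℝ} {f' : E → E} {L γ β : ℝ}
    (hfconv : ConvexOn ℝ Set.univ f) (hgconv : ConvexOn ℝ Set.univ g)
    (hf : ∀ x, HasGradientAt f (f' x) x) (hlip : ∀ x y, ‖f' x - f' y‖ ≤ L * ‖x - y‖)
    (hγ : 0 < γ) {u v p : E}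
    (hp : IsMinOn (fun z => ‖z - (v - γ • f' v + β • (v - u))‖ ^ 2 / (2 * γ) + g z) Set.univ p)
    (z : E) :
    γ * (f p + g p - (f z + g z)) ≤
      γ * (L / 2) * ‖p - v‖ ^ 2 + ⟪v - p, p - z⟫_ℝ + β * ⟪v - u, p - z⟫_ℝ := by
  have h1 := hgconv.add_inner_le_of_isMinOn_prox hγ hp z
  have h2 := mul_le_mul_of_nonneg_left (le_add_inner_add_of_lipschitz_gradient hf hlip v p) hγ.le
  have h3 := mul_le_mul_of_nonneg_left (hfconv.add_inner_gradient_le (hf v) z) hγ.le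
  have h4 : ⟪v - γ • f' v + β • (v - u) - p, z - p⟫_ℝ =
      -⟪v - p, p - z⟫_ℝ - β * ⟪v - u, p - z⟫_ℝ
        - γ * (⟪f' v, z - v⟫_ℝ - ⟪f' v, p - v⟫_ℝ) := by
    rw [← inner_sub_right, sub_sub_sub_cancel_right, ← neg_sub z p, inner_neg_right,
      inner_neg_right, show v - γ • f' v + β • (v - u) - p
        = (v - p) - γ • f' v + β • (v - u) by abel, inner_add_left, inner_sub_left,
      real_inner_smul_left, real_inner_smul_left]
    ring
  rw [h4] at h1
  linarith

theorem two_mul_inner_le_add_sq (u v : E) : 2 * ⟪u, v⟫_ℝ ≤ ‖u‖ ^ 2 + ‖v‖ ^ 2 := by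
  have := norm_sub_sq_real u v
  linarith [sq_nonneg ‖u - v‖]

theorem two_mul_inner_sub_sub (v p z : E) :
    2 * ⟪v - p, p - z⟫_ℝ = ‖v - z‖ ^ 2 - ‖p - z‖ ^ 2 - ‖p - v‖ ^ 2 := by
  have := norm_add_sq_real (v - p) (p - z)
  rw [sub_add_sub_cancel, norm_sub_rev v p] at this
  linarith

end ProximalGradient


/-- Theorem 2, `O(1/k)` rate for PIGD without coercivity. Under the PIGD
setup with `argmin F` nonempty and `β_k = 1/(k+1)^θ` for some `θ > 1`, one has
`F(xᵏ) − min F ≤ C/k` for all `k ≥ 1`. -/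
theorem pigd_stmt5
    {n : ℕ} (f g F : EuclideanSpace ℝ (Fin n) → ℝ)
    (f' : EuclideanSpace ℝ (Fin n) → EuclideanSpace ℝ (Fin n))
    (L c : ℝ) (hL : 0 < L) (hc0 : 0 < c) (hc1 : c < 1)
    (hfconv : ConvexOn ℝ Set.univ f)
    (hgconv : ConvexOn ℝ Set.univ g)
    (hgcont : Continuous g)
    (hf' : ∀ x, HasGradientAt f (f' x) x)
    (hlip : ∀ x y, ‖f' x - f' y‖ ≤ L * ‖x - y‖)
    (hF : ∀ x, F x = f x + g x)
    (hFbdd : BddBelow (Set.range F))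
    (β γ : ℕ → ℝ)
    (hβnonneg : ∀ k, 0 ≤ β k)
    (hβmono : ∀ k, β (k + 1) ≤ β k)
    (hγ : ∀ k, γ k = 2 * (1 - β k) * c / L)
    (prox : ℝ → EuclideanSpace ℝ (Fin n) → EuclideanSpace ℝ (Fin n))
    (hprox : ∀ (γ' : ℝ) (y : EuclideanSpace ℝ (Fin n)), 0 < γ' →
      IsMinOn (fun z => ‖z - y‖ ^ 2 / (2 * γ') + g z) Set.univ (prox γ' y))
    (x : ℤ → EuclideanSpace ℝ (Fin n))
    (hiter : ∀ k : ℕ,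
      x (k + 1) = prox (γ k) (x k - γ k • f' (x k) + β k • (x k - x ((k : ℤ) - 1))))
    -- `argmin F` is nonempty and `F xstar = min F`
    (xstar : EuclideanSpace ℝ (Fin n)) (hxstar : ∀ y, F xstar ≤ F y)
    -- inertial parameters `β_k = 1/(k+1)^θ`, `θ > 1`
    (θ : ℝ) (hθ : 1 < θ) (hβ : ∀ k : ℕ, β k = 1 / ((k : ℝ) + 1) ^ θ) :
    ∃ C : ℝ, 0 < C ∧ ∀ k : ℕ, 1 ≤ k → F (x k) - F xstar ≤ C / k := by
  have hβs : Summable fun j : ℕ => β (j + 1) := by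
    rw [summable_nat_add_iff 1 (f := β)]
    have := (summable_nat_add_iff 1).2 (Real.summable_one_div_nat_rpow.2 hθ)
    refine this.congr fun k => ?_
    rw [hβ]; push_cast; rfl
  have hβhalf : ∀ j : ℕ, β (j + 1) ≤ 1 / 2 := by
    intro j
    have h1 : β (j + 1) ≤ β 1 := antitone_nat_of_succ_le hβmono (by omega)
    have h2 : (2 : ℝ) ≤ 2 ^ θ := by
      simpa using Real.rpow_le_rpow_of_exponent_le (one_le_two (α := ℝ)) hθ.le
    have h3 : β 1 ≤ 1 / 2 := by
      rw [hβ, Nat.cast_one, one_add_one_eq_two]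
      exact one_div_le_one_div_of_le two_pos h2
    linarith
  have hγL : ∀ k, γ k * L = 2 * (1 - β k) * c := fun k => by rw [hγ]; field_simp
  have hγlow : ∀ j : ℕ, c / L ≤ γ (j + 1) := by
    intro j
    rw [div_le_iff₀ hL, hγL]
    nlinarith [hβhalf j]
  have hγpos : ∀ j : ℕ, 0 < γ (j + 1) := fun j => (div_pos hc0 hL).trans_le (hγlow j)
  have hγanti : ∀ j : ℕ, γ (j + 1) ≤ γ (j + 2) := by
    intro j
    refine le_of_mul_le_mul_right ?_ hL
    rw [hγL, hγL]
    nlinarith [hβmono (j + 1)]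
  set X : ℕ → EuclideanSpace ℝ (Fin n) := fun j => x j with hX
  have hmin : ∀ j : ℕ, IsMinOn
      (fun z => ‖z - (X (j + 1) - γ (j + 1) • f' (X (j + 1)) + β (j + 1) • (X (j + 1) - X j))‖ ^ 2
        / (2 * γ (j + 1)) + g z) Set.univ (X (j + 2)) := by
    intro j
    have h1 := hiter (j + 1)
    have h2 := hprox (γ (j + 1)) (X (j + 1) - γ (j + 1) • f' (X (j + 1))
      + β (j + 1) • (X (j + 1) - X j)) (hγpos j)
    have h3 : X (j + 2) = prox (γ (j + 1)) (X (j + 1) - γ (j + 1) • f' (X (j + 1))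
        + β (j + 1) • (X (j + 1) - X j)) := by
      simp only [hX]
      push_cast at h1 ⊢
      rw [add_sub_cancel_right, add_assoc, one_add_one_eq_two] at h1
      exact h1
    rw [h3]
    exact h2
  have hstep := fun j z => inertial_proximal_gradient_step hfconv hgconv hf' hlip (hγpos j)
    (hmin j) z
  simp only [← hF] at hstep
  have hm : 0 < 2 * (c / L) := by positivity
  have hκ : 0 < L * (1 - c) / (2 * c) := div_pos (mul_pos hL (by linarith)) (by positivity)
  obtain ⟨C, hC, hCa⟩ := exists_le_div_of_lyapunov_of_quasiFejer
    (a := fun j => F (X (j + 1)) - F xstar) (d := fun j => ‖X (j + 1) - X j‖ ^ 2)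
    (D := fun j => ‖X (j + 1) - xstar‖ ^ 2) (w := fun j => β (j + 1) / (2 * γ (j + 1)))
    (b := fun j => β (j + 1)) (W := 1 / 2 / (2 * (c / L))) hκ hm
    (fun j => sub_nonneg.2 (hxstar _)) (fun j => by positivity) (fun j => by positivity)
    (fun j => div_nonneg (hβnonneg _) (by linarith [hγpos j]))
    (fun j => div_le_div₀ (by norm_num) (hβhalf j) hm (by linarith [hγlow j]))
    (fun j => hβnonneg _) hβs
    (fun j => by
      have h1 := hstep j (X (j + 1))
      have h2 := two_mul_inner_le_add_sq (X (j + 1) - X j) (X (j + 2) - X (j + 1))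
      have h3 : inner ℝ (X (j + 1) - X (j + 2)) (X (j + 2) - X (j + 1))
          = -‖X (j + 2) - X (j + 1)‖ ^ 2 := by
        rw [← neg_sub (X (j + 2)), inner_neg_left, real_inner_self_eq_norm_sq]
      have h4 : β (j + 2) / (2 * γ (j + 2)) ≤ β (j + 1) / (2 * γ (j + 1)) :=
        div_le_div₀ (hβnonneg _) (hβmono _) (by linarith [hγpos j]) (by linarith [hγanti j])
      rw [h3] at h1
      have h5 := mul_le_mul_of_nonneg_left h2 (hβnonneg (j + 1))
      have h6 := mul_le_mul_of_nonneg_right h4 (sq_nonneg ‖X (j + 2) - X (j + 1)‖)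
      have h7 : γ (j + 1) * (β (j + 1) / (2 * γ (j + 1))) = β (j + 1) / 2 := by
        have := (hγpos j).ne'
        field_simp
      have h8 : γ (j + 1) * (L * (1 - c) / (2 * c)) = (1 - β (j + 1)) * (1 - c) := by
        rw [mul_div_assoc', ← mul_assoc, hγL]
        field_simp
      have h9 : γ (j + 1) * (L / 2) = (1 - β (j + 1)) * c := by
        rw [mul_div_assoc', hγL]; ring
      refine le_of_mul_le_mul_left ?_ (hγpos j)
      have h10 := mul_le_mul_of_nonneg_left h6 (hγpos j).le
      rw [h9] at h1
      rw [← mul_assoc (γ (j + 1)) (β (j + 1) / (2 * γ (j + 1))), h7] at h10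
      simp only [mul_add (γ (j + 1)), ← mul_assoc, h7, h8]
      rw [mul_assoc (γ (j + 1))]
      linarith)
    (fun j => by
      have h1 := hstep j xstar
      have h2 := two_mul_inner_le_add_sq (X (j + 1) - X j) (X (j + 2) - X (j + 1))
      have h3 := two_mul_inner_le_add_sq (X (j + 1) - X j) (X (j + 1) - xstar)
      have h4 := two_mul_inner_sub_sub (X (j + 1)) (X (j + 2)) xstar
      have h5 : inner ℝ (X (j + 1) - X j) (X (j + 2) - xstar)
          = inner ℝ (X (j + 1) - X j) (X (j + 2) - X (j + 1)) + inner ℝ (X (j + 1) - X j) (X (j + 1) - xstar) := by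
        rw [← inner_add_right, sub_add_sub_cancel]
      have h6 : γ (j + 1) * (L / 2) ≤ 1 := by
        rw [mul_div_assoc', hγL]
        nlinarith [hβnonneg (j + 1), hβhalf j]
      have h7 := mul_le_mul_of_nonneg_right h6 (sq_nonneg ‖X (j + 2) - X (j + 1)‖)
      have h8 := mul_le_mul_of_nonneg_left (add_le_add h2 h3) (hβnonneg (j + 1))
      have h9 := mul_le_mul_of_nonneg_right (hγlow j) (sub_nonneg.2 (hxstar (X (j + 2))))
      have h10 := mul_le_mul_of_nonneg_right (hβhalf j) (sq_nonneg ‖X (j + 2) - X (j + 1)‖)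
      have h11 := mul_le_mul_of_nonneg_right (hβhalf j) (sq_nonneg ‖X (j + 1) - X j‖)
      rw [h5] at h1
      have h12 := sq_nonneg ‖X (j + 2) - X (j + 1)‖
      have h13 := sq_nonneg ‖X (j + 1) - X j‖
      show ‖X (j + 2) - xstar‖ ^ 2 + 2 * (c / L) * (F (X (j + 2)) - F xstar) ≤
        (1 + β (j + 1)) * ‖X (j + 1) - xstar‖ ^ 2
          + (3 * ‖X (j + 2) - X (j + 1)‖ ^ 2 + 2 * ‖X (j + 1) - X j‖ ^ 2)
      linarith)
  refine ⟨C, hC, fun k hk => ?_⟩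
  obtain ⟨j, rfl⟩ := Nat.exists_eq_add_of_le' hk
  simpa [hX] using hCa j
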